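/- arXiv:2412.16222 — 3 statements merged into one kernel-verified Lean document; each statement's English description precedes it below -/
import Mathlib

section
/- Fix a period t ∈ ℕ with t ≥ 1, a period length L > 0, and a due date d ∈ ℝ. Suppose the n ≥ 1 operations of a job processed in period t have quantities x_1, …, x_n ≥ 0, unit processing times p_1, …, p_n ≥ 0, and learning indices a_1, …, a_n ≤ 0, so the duration of operation h is δ_h = x_h · p_h · (t : ℝ)^{a_h}. Suppose there are start times s_h and finish times f_h with f_h = s_h + δ_h, s_{h+1} ≥ f_h for 1 ≤ h < n, and s_1 ≥ L·(t − 1), and let F = f_n be the job's finish time in period t. Then every real number Tr satisfying Tr ≥ F − d and Tr ≥ 0 also satisfies Tr ≥ (L·(t − 1) + Σ_{h=1}^n x_h · p_h · (t : ℝ)^{a_h}) − d. -/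
/-- In a chain of non-overlapping operations with durations `δ`, the last finish time is at least
the release time plus the total duration. -/
theorem add_sum_duration_le_finish {m : ℕ} {c : ℝ} {s f δ : ℕ → ℝ}
    (hf : ∀ h ≤ m, f h = s h + δ h) (hchain : ∀ h < m, f h ≤ s (h + 1)) (hstart : c ≤ s 0) :
    c + ∑ h ∈ Finset.range (m + 1), δ h ≤ f m := by
  induction m with
  | zero => simpa [hf 0 le_rfl] using hstart
  | succ m ih =>
    have hprev := ih (fun h hh => hf h (by omega)) (fun h hh => hchain h (by omega))
    rw [Finset.sum_range_succ, hf (m + 1) le_rfl]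
    linarith [hchain m (by omega)]

/-- Lemma 2, case u = 1: the lower-bound expression of Relation (34)
never exceeds the true tardiness, under the period-based learning effect. -/
theorem lower_bound_one_valid
    (t : ℕ) (ht : 1 ≤ t) (L : ℝ) (hL : 0 < L) (d : ℝ)
    (n : ℕ) (hn : 1 ≤ n)
    (x p a : ℕ → ℝ)
    (hx : ∀ h < n, 0 ≤ x h)
    (hp : ∀ h < n, 0 ≤ p h)
    (ha : ∀ h < n, a h ≤ 0)
    (s f : ℕ → ℝ)
    (hf : ∀ h < n, f h = s h + x h * p h * (t : ℝ) ^ (a h))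
    (hchain : ∀ h, h + 1 < n → s (h + 1) ≥ f h)
    (hstart : s 0 ≥ L * ((t : ℝ) - 1))
    (F : ℝ) (hF : F = f (n - 1))
    (Tr : ℝ) (hTr₁ : Tr ≥ F - d) (hTr₂ : Tr ≥ 0) :
    Tr ≥ (L * ((t : ℝ) - 1) + ∑ h ∈ Finset.range n, x h * p h * (t : ℝ) ^ (a h)) - d := by
  obtain ⟨m, rfl⟩ : ∃ m, n = m + 1 := ⟨n - 1, by omega⟩
  rw [Nat.add_sub_cancel] at hF
  have hfinish := add_sum_duration_le_finish (m := m) (fun h hh => hf h (by omega))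
    (fun h hh => hchain h (by omega)) hstart
  linarith
end

section
/- Fix naturals 1 ≤ t ≤ T, a period length L > 0, and a due date d ∈ ℝ. For operations h = 1, …, n of a job, let p_h ≥ 0 be unit processing times, a_h ≤ 0 learning indices, R_h ≥ 0 the remaining work of operation h at the start of period t, and x_h the quantity of operation h processed in period t, with x_h ≥ R_h. Suppose the job's finish time F in period t satisfies F ≥ L·(t − 1) + Σ_{h=1}^n x_h · p_h · (t : ℝ)^{a_h}. Then every real number Tr with Tr ≥ F − d and Tr ≥ 0 satisfies Tr ≥ Σ_{h=1}^n R_h · p_h · (T : ℝ)^{a_h} − (d − L·(t − 1)). -/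
/-- Lemma 3, Case 1: if all remaining work of a job is processed within
period `t`, the lower-bound expression of Relation (36) never exceeds the true
tardiness. -/
theorem lower_bound_two_case_one
    (t T : ℕ) (ht : 1 ≤ t) (htT : t ≤ T) (L : ℝ) (hL : 0 < L) (d : ℝ)
    (n : ℕ)
    (p a R x : ℕ → ℝ)
    (hp : ∀ h < n, 0 ≤ p h)
    (ha : ∀ h < n, a h ≤ 0)
    (hR : ∀ h < n, 0 ≤ R h)
    (hxR : ∀ h < n, R h ≤ x h)
    (F : ℝ)
    (hF : F ≥ L * ((t : ℝ) - 1) + ∑ h ∈ Finset.range n, x h * p h * (t : ℝ) ^ (a h))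
    (Tr : ℝ) (hTr₁ : Tr ≥ F - d) (hTr₂ : Tr ≥ 0) :
    Tr ≥ (∑ h ∈ Finset.range n, R h * p h * (T : ℝ) ^ (a h)) - (d - L * ((t : ℝ) - 1)) := by
  have ht_pos : (0 : ℝ) < t := by exact_mod_cast ht
  have ht_le : (t : ℝ) ≤ T := by exact_mod_cast htT
  have hsum : ∑ h ∈ Finset.range n, R h * p h * (T : ℝ) ^ (a h) ≤
      ∑ h ∈ Finset.range n, x h * p h * (t : ℝ) ^ (a h) := by
    refine Finset.sum_le_sum fun h hh => ?_
    have hn := Finset.mem_range.mp hh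
    have hp_nonneg := hp h hn
    have hx_nonneg := (hR h hn).trans (hxR h hn)
    exact mul_le_mul (mul_le_mul_of_nonneg_right (hxR h hn) hp_nonneg)
      (Real.rpow_le_rpow_of_nonpos ht_pos ht_le (ha h hn)) (by positivity) (by positivity)
  linarith
end

section
/- Let H, T ≥ 1 be naturals and let x : Fin H → Fin T → ℝ be nonnegative production quantities, where x h t is the quantity of operation h produced in period t. Suppose that for every operation h < H − 1 and every period t, x (h+1) t ≤ Σ_{t' ≤ t} x h t' − Σ_{t' < t} x (h+1) t' (Constraint (23) of Model-II). Then cumulative production is monotone along the operation chain: for all operations h ≤ h' and every period t, Σ_{t' ≤ t} x h' t' ≤ Σ_{t' ≤ t} x h t'. -/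
/-- Constraint (23) of Model-II implies that cumulative production is
monotone (nonincreasing) along the operation chain. -/
theorem cumulative_production_monotone
    (H T : ℕ) (hH : 1 ≤ H) (hT : 1 ≤ T)
    (x : Fin H → Fin T → ℝ)
    (hx : ∀ h t, 0 ≤ x h t)
    (h23 : ∀ (h : ℕ) (hh : h + 1 < H) (t : Fin T),
      x ⟨h + 1, hh⟩ t ≤
        (∑ t' ∈ Finset.Iic t, x ⟨h, Nat.lt_of_succ_lt hh⟩ t') -
        ∑ t' ∈ Finset.Iio t, x ⟨h + 1, hh⟩ t') :
    ∀ (h h' : Fin H), h ≤ h' → ∀ t : Fin T,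
      ∑ t' ∈ Finset.Iic t, x h' t' ≤ ∑ t' ∈ Finset.Iic t, x h t' := by
  rintro ⟨h, hh⟩ ⟨h', hh'⟩ hle t
  replace hle : h ≤ h' := hle
  induction h', hle using Nat.le_induction with
  | base => exact le_rfl
  | succ k _ ih =>
    refine le_trans ?_ (ih (Nat.lt_of_succ_lt hh'))
    rw [← Finset.Iio_insert t, Finset.sum_insert Finset.notMem_Iio_self, Finset.Iio_insert]
    exact le_sub_iff_add_le.mp (h23 k hh' t)
end
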